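/- Let E be a real inner product space, let g : E → ℝ be differentiable with gradient map ∇g : E → E satisfying ‖∇g(u) − ∇g(v)‖ ≤ L‖u − v‖ for all u, v ∈ E and some L > 0, let h : E → ℝ, set f := g + h, and suppose f(u) ≥ f* for all u ∈ E and some f* ∈ ℝ. Fix a stepsize λ ∈ (0, 1/L) and a sequence (p_k) in E such that for every k: h(p_{k+1}) + (1/(2λ))·‖p_{k+1} − (p_k − λ∇g(p_k))‖² ≤ h(p_k) + (λ/2)·‖∇g(p_k)‖². Then the sequence (f(p_k)) is nonincreasing, and ‖p_{k+1} − p_k‖ → 0 as k → ∞. -/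

import Mathlib

open scoped RealInnerProductSpace

/-- The descent lemma: a function with `L`-Lipschitz gradient lies below its quadratic model. -/
theorem descent_of_lipschitz_gradient
    {E : Type*} [NormedAddCommGroup E] [InnerProductSpace ℝ E]
    {g : E → ℝ} {gradg : E → E} {L : ℝ}
    (hdiff : ∀ u : E, HasFDerivAt g ((innerSL ℝ) (gradg u)) u)
    (hlip : ∀ u v : E, ‖gradg u - gradg v‖ ≤ L * ‖u - v‖) (u d : E) :
    g (u + d) ≤ g u + ⟪gradg u, d⟫ + L / 2 * ‖d‖ ^ 2 := by
  have hderiv (t : ℝ) : HasDerivAt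
      (fun t : ℝ => g (u + t • d) - t * ⟪gradg u, d⟫ - t ^ 2 * (L / 2 * ‖d‖ ^ 2))
      (⟪gradg (u + t • d), d⟫ - ⟪gradg u, d⟫ - 2 * t * (L / 2 * ‖d‖ ^ 2)) t := by
    have hline : HasDerivAt (fun t : ℝ => u + t • d) d t := by
      simpa using ((hasDerivAt_id t).smul_const d).const_add u
    have hg := (hdiff (u + t • d)).comp_hasDerivAt t hline
    have hlin := (hasDerivAt_id t).mul_const ⟪gradg u, d⟫
    have hsq := (hasDerivAt_pow 2 t).mul_const (L / 2 * ‖d‖ ^ 2)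
    refine ((hg.sub hlin).sub hsq).congr_deriv ?_
    simp
  have hanti : AntitoneOn
      (fun t : ℝ => g (u + t • d) - t * ⟪gradg u, d⟫ - t ^ 2 * (L / 2 * ‖d‖ ^ 2))
      (Set.Icc 0 1) := by
    refine antitoneOn_of_deriv_nonpos (convex_Icc 0 1)
      (fun t _ => (hderiv t).continuousAt.continuousWithinAt)
      (fun t _ => (hderiv t).differentiableAt.differentiableWithinAt) fun t ht => ?_
    rw [interior_Icc] at ht
    have hgrad := hlip (u + t • d) u
    rw [add_sub_cancel_left, norm_smul, Real.norm_of_nonneg ht.1.le] at hgrad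
    have hinner := (real_inner_le_norm (gradg (u + t • d) - gradg u) d).trans
      (mul_le_mul_of_nonneg_right hgrad (norm_nonneg d))
    rw [inner_sub_left] at hinner
    rw [(hderiv t).deriv]
    linarith
  have hle := hanti (Set.left_mem_Icc.2 zero_le_one) (Set.right_mem_Icc.2 zero_le_one) zero_le_one
  simp at hle
  linarith

/-- A real sequence bounded below that decreases by at least `c * a k ^ 2` at step `k`
forces `a` to vanish. -/
theorem tendsto_zero_of_sufficient_decrease {F a : ℕ → ℝ} {c m : ℝ} (hc : 0 < c)
    (hm : ∀ k, m ≤ F k) (hF : ∀ k, F (k + 1) + c * a k ^ 2 ≤ F k) :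
    Filter.Tendsto a Filter.atTop (nhds 0) := by
  have hanti : Antitone F := antitone_nat_of_succ_le fun k => by
    nlinarith [hF k, sq_nonneg (a k)]
  have hlim := tendsto_atTop_ciInf hanti ⟨m, Set.forall_mem_range.2 hm⟩
  have hdecr : Filter.Tendsto (fun k => (F k - F (k + 1)) / c) Filter.atTop (nhds 0) := by
    simpa using (hlim.sub (hlim.comp (Filter.tendsto_add_atTop_nat 1))).div_const c
  have hsq : Filter.Tendsto (fun k => a k ^ 2) Filter.atTop (nhds 0) :=
    squeeze_zero (fun k => sq_nonneg (a k))
      (fun k => (le_div_iff₀ hc).2 (by linarith [hF k])) hdecr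
  rw [tendsto_zero_iff_abs_tendsto_zero]
  simpa [Function.comp_def, Real.sqrt_sq_eq_abs] using hsq.sqrt

/-- Euclidean monotone decrease and vanishing step property of the nonconvex
proximal gradient method with constant stepsize `λ ∈ (0, 1/L)`: the values
`f(p_k)` are nonincreasing and `‖p_{k+1} - p_k‖ → 0`. -/
theorem prox_grad_monotone_and_vanishing_steps
    {E : Type*} [NormedAddCommGroup E] [InnerProductSpace ℝ E]
    (g h : E → ℝ) (gradg : E → E) (L : ℝ) (hL : 0 < L)
    (hdiff : ∀ u : E, HasFDerivAt g ((innerSL ℝ) (gradg u)) u)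
    (hlip : ∀ u v : E, ‖gradg u - gradg v‖ ≤ L * ‖u - v‖)
    (fstar : ℝ) (hbdd : ∀ u : E, fstar ≤ g u + h u)
    (lam : ℝ) (hlam : 0 < lam) (hlamL : lam < 1 / L)
    (p : ℕ → E)
    (hstep : ∀ k : ℕ,
      h (p (k + 1)) + 1 / (2 * lam) * ‖p (k + 1) - (p k - lam • gradg (p k))‖ ^ 2 ≤
        h (p k) + lam / 2 * ‖gradg (p k)‖ ^ 2) :
    (∀ k : ℕ, g (p (k + 1)) + h (p (k + 1)) ≤ g (p k) + h (p k)) ∧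
      Filter.Tendsto (fun k => ‖p (k + 1) - p k‖) Filter.atTop (nhds 0) := by
  have hc : 0 < 1 / (2 * lam) - L / 2 := by
    rw [lt_div_iff₀ hL] at hlamL
    rw [sub_pos, div_lt_div_iff₀ two_pos (by positivity)]
    linarith
  have hdecr (k : ℕ) : g (p (k + 1)) + h (p (k + 1)) +
      (1 / (2 * lam) - L / 2) * ‖p (k + 1) - p k‖ ^ 2 ≤ g (p k) + h (p k) := by
    have hdesc := descent_of_lipschitz_gradient hdiff hlip (p k) (p (k + 1) - p k)
    rw [add_sub_cancel] at hdesc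
    have hexp : 1 / (2 * lam) * ‖p (k + 1) - (p k - lam • gradg (p k))‖ ^ 2 =
        1 / (2 * lam) * ‖p (k + 1) - p k‖ ^ 2 + ⟪gradg (p k), p (k + 1) - p k⟫ +
          lam / 2 * ‖gradg (p k)‖ ^ 2 := by
      rw [← sub_add, norm_add_sq_real, real_inner_smul_right, norm_smul,
        Real.norm_of_nonneg hlam.le, real_inner_comm]
      field_simp
    have := hstep k
    linarith
  exact ⟨fun k => by nlinarith [hdecr k, sq_nonneg ‖p (k + 1) - p k‖],
    tendsto_zero_of_sufficient_decrease hc (fun k => hbdd (p k)) hdecr⟩
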